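/- Define, for positive reals t012, e01, e10, e12, e21, the polynomials ⊤_c = e01·e10²·e12²·e21·t012 − e12³ − 1 and ⊥_c = e21³·t012 + t012 − e01²·e10·e12·e21². Let F_c = { (t012, e01, e10, e12, e21, e20) ∈ (0,∞)⁶ : e10·e12²·t012·⊥_c·e20 = e21·⊤_c }. Then F_c is a closed subset of (0,∞)⁶ (in the subspace topology) and F_c, with its subspace topology, is homeomorphic to ℝ⁵. -/

import Mathlib

/-- `⊤_c`, as a function of `(t012, e01, e10, e12, e21)`. -/
def topC (t012 e01 e10 e12 e21 : ℝ) : ℝ :=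
  e01 * e10 ^ 2 * e12 ^ 2 * e21 * t012 - e12 ^ 3 - 1

/-- `⊥_c`, as a function of `(t012, e01, e10, e12, e21)`. -/
def botC (t012 e01 e10 e12 e21 : ℝ) : ℝ :=
  e21 ^ 3 * t012 + t012 - e01 ^ 2 * e10 * e12 * e21 ^ 2

/-- The positive orthant `(0,∞)⁶`, with coordinates `(t012, e01, e10, e12, e21, e20)`. -/
def posOrthant6 : Set (Fin 6 → ℝ) := {x | ∀ i, 0 < x i}

/-- The cyan flat set `F_c` in `(0,∞)⁶`, with coordinates `(t012, e01, e10, e12, e21, e20)`. -/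
def cyanFlatSet : Set (Fin 6 → ℝ) :=
  {x | (∀ i, 0 < x i) ∧
    x 2 * (x 3) ^ 2 * x 0 * botC (x 0) (x 1) (x 2) (x 3) (x 4) * x 5 =
      x 4 * topC (x 0) (x 1) (x 2) (x 3) (x 4)}

/-- The positive root in `a` of `A * a ^ 2 + B * a = C`. -/
noncomputable def posRoot (A B C : ℝ) : ℝ := (√(B ^ 2 + 4 * A * C) - B) / (2 * A)

theorem posRoot_pos {A B C : ℝ} (hA : 0 < A) (hC : 0 < C) : 0 < posRoot A B C := by
  have h : B < √(B ^ 2 + 4 * A * C) := by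
    apply Real.lt_sqrt_of_sq_lt
    have : 0 < 4 * A * C := by positivity
    linarith
  exact div_pos (sub_pos.2 h) (by positivity)

theorem posRoot_spec {A B C : ℝ} (hA : 0 < A) (hC : 0 < C) :
    A * posRoot A B C ^ 2 + B * posRoot A B C = C := by
  have h : √(B ^ 2 + 4 * A * C) ^ 2 = B ^ 2 + 4 * A * C := Real.sq_sqrt (by positivity)
  unfold posRoot
  generalize √(B ^ 2 + 4 * A * C) = s at h ⊢
  field_simp
  linear_combination h

theorem eq_posRoot {A B C a : ℝ} (hA : 0 < A) (hB : 0 < B) (ha : 0 < a)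
    (h : A * a ^ 2 + B * a = C) : a = posRoot A B C := by
  have hs : √(B ^ 2 + 4 * A * C) = 2 * A * a + B := by
    rw [← h, ← Real.sqrt_sq (by positivity : 0 ≤ 2 * A * a + B)]
    congr 1
    ring
  unfold posRoot
  rw [hs]
  field_simp
  ring

/-- The value of `e01` solving the cyan flatness equation for the other coordinates. -/
noncomputable def flatE01 (t b c d f : ℝ) : ℝ :=
  posRoot (b ^ 2 * c ^ 3 * t * f * d ^ 2) (b ^ 2 * c ^ 2 * d ^ 2 * t)
    (b * c ^ 2 * t ^ 2 * f * (d ^ 3 + 1) + d * (c ^ 3 + 1))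

theorem flatE01_pos {t b c d f : ℝ} (ht : 0 < t) (hb : 0 < b) (hc : 0 < c) (hd : 0 < d)
    (hf : 0 < f) : 0 < flatE01 t b c d f :=
  posRoot_pos (by positivity) (by positivity)

theorem flat_iff {t a b c d f : ℝ} (ht : 0 < t) (ha : 0 < a) (hb : 0 < b) (hc : 0 < c)
    (hd : 0 < d) (hf : 0 < f) :
    b * c ^ 2 * t * botC t a b c d * f = d * topC t a b c d ↔ a = flatE01 t b c d f := by
  unfold botC topC
  constructor
  · intro h
    exact eq_posRoot (by positivity) (by positivity) ha (by linear_combination -h)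
  · rintro rfl
    have h := posRoot_spec (A := b ^ 2 * c ^ 3 * t * f * d ^ 2) (B := b ^ 2 * c ^ 2 * d ^ 2 * t)
      (C := b * c ^ 2 * t ^ 2 * f * (d ^ 3 + 1) + d * (c ^ 3 + 1)) (by positivity) (by positivity)
    unfold flatE01
    linear_combination -h

theorem isClosed_cyanFlatSet :
    IsClosed (Subtype.val ⁻¹' cyanFlatSet : Set ↥posOrthant6) := by
  have h : IsClosed {x : Fin 6 → ℝ |
      x 2 * (x 3) ^ 2 * x 0 * botC (x 0) (x 1) (x 2) (x 3) (x 4) * x 5 =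
        x 4 * topC (x 0) (x 1) (x 2) (x 3) (x 4)} := by
    unfold botC topC
    exact isClosed_eq (by fun_prop) (by fun_prop)
  convert h.preimage (continuous_subtype_val (p := (· ∈ posOrthant6))) using 1
  ext x
  exact and_iff_right x.2

/-- The point of the orthant with coordinates `exp ∘ y` off `e01`, and `e01` given by flatness. -/
noncomputable def flatPoint (y : Fin 5 → ℝ) : Fin 6 → ℝ :=
  ![Real.exp (y 0),
    flatE01 (Real.exp (y 0)) (Real.exp (y 1)) (Real.exp (y 2)) (Real.exp (y 3)) (Real.exp (y 4)),
    Real.exp (y 1), Real.exp (y 2), Real.exp (y 3), Real.exp (y 4)]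

theorem flatPoint_mem (y : Fin 5 → ℝ) : flatPoint y ∈ cyanFlatSet := by
  have hpos := flatE01_pos (Real.exp_pos (y 0)) (Real.exp_pos (y 1)) (Real.exp_pos (y 2))
    (Real.exp_pos (y 3)) (Real.exp_pos (y 4))
  refine ⟨fun i => ?_, ?_⟩
  · fin_cases i
    exacts [Real.exp_pos _, hpos, Real.exp_pos _, Real.exp_pos _, Real.exp_pos _, Real.exp_pos _]
  · exact (flat_iff (Real.exp_pos _) hpos (Real.exp_pos _) (Real.exp_pos _) (Real.exp_pos _)
      (Real.exp_pos _)).2 rfl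

theorem continuous_flatPoint : Continuous flatPoint := by
  refine continuous_pi fun i => ?_
  fin_cases i
  rotate_left
  · change Continuous fun y : Fin 5 → ℝ => flatE01 (Real.exp (y 0)) (Real.exp (y 1))
      (Real.exp (y 2)) (Real.exp (y 3)) (Real.exp (y 4))
    unfold flatE01 posRoot
    exact Continuous.div (by fun_prop) (by fun_prop) fun y => by positivity
  all_goals exact Real.continuous_exp.comp (continuous_apply _)

/-- Logarithms of the coordinates other than `e01` parametrize the cyan flat set by `ℝ⁵`. -/
noncomputable def cyanFlatSetHomeomorph : ↥cyanFlatSet ≃ₜ (Fin 5 → ℝ) where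
  toFun x i := Real.log (x.1 (Fin.succAbove 1 i))
  invFun y := ⟨flatPoint y, flatPoint_mem y⟩
  left_inv := by
    rintro ⟨x, hx, h⟩
    have h1 := (flat_iff (hx 0) (hx 1) (hx 2) (hx 3) (hx 4) (hx 5)).1 h
    have he (i : Fin 6) : Real.exp (Real.log (x i)) = x i := Real.exp_log (hx i)
    ext i
    fin_cases i
    rotate_left
    · change flatE01 (Real.exp (Real.log (x 0))) (Real.exp (Real.log (x 2)))
        (Real.exp (Real.log (x 3))) (Real.exp (Real.log (x 4))) (Real.exp (Real.log (x 5))) = x 1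
      simp only [he, ← h1]
    all_goals exact he _
  right_inv y := by
    ext i
    fin_cases i <;> exact Real.log_exp _
  continuous_toFun := continuous_pi fun i =>
    Continuous.log ((continuous_apply _).comp continuous_subtype_val) fun x => (x.2.1 _).ne'
  continuous_invFun := continuous_flatPoint.subtype_mk _

theorem stmt_5 :
    IsClosed (Subtype.val ⁻¹' cyanFlatSet : Set ↥posOrthant6) ∧
    Nonempty (↥cyanFlatSet ≃ₜ (Fin 5 → ℝ)) := by
  exact ⟨isClosed_cyanFlatSet, ⟨cyanFlatSetHomeomorph⟩⟩
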